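/- arXiv:2504.16211 — 2 statements merged into one kernel-verified Lean document; each statement's English description precedes it below -/
import Mathlib

section
/- Let a be a real with 0 < a ≤ 20, and let g₁, g₂, g₃ be nonnegative reals satisfying g₂ ≤ g₁ − 2g₃. Then for every integer t ≥ 1, a / (20 (t+1)^{g₁ − 2g₃}) + (t+1)^{1 − g₂} − t^{1 − g₂} − 2 / (t+1)^{g₂} ≤ 0. -/
open Real

/-- For `0 < a ≤ 20` and nonnegative reals `g₁, g₂, g₃` with `g₂ ≤ g₁ − 2g₃`, for every
integer `t ≥ 1`,
`a / (20 (t+1)^{g₁ − 2g₃}) + (t+1)^{1 − g₂} − t^{1 − g₂} − 2 / (t+1)^{g₂} ≤ 0`. -/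
theorem stmt_10 (a g₁ g₂ g₃ : ℝ) (ha0 : 0 < a) (ha : a ≤ 20)
    (hg₁ : 0 ≤ g₁) (hg₂ : 0 ≤ g₂) (hg₃ : 0 ≤ g₃) (hg : g₂ ≤ g₁ - 2 * g₃) :
    ∀ t : ℕ, 1 ≤ t →
      a / (20 * ((t : ℝ) + 1) ^ (g₁ - 2 * g₃)) + ((t : ℝ) + 1) ^ (1 - g₂)
          - (t : ℝ) ^ (1 - g₂) - 2 / ((t : ℝ) + 1) ^ g₂ ≤ 0 := by
  intro t ht
  have ht0 : (0 : ℝ) < t := by exact_mod_cast ht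
  have hs0 : (0 : ℝ) < (t : ℝ) + 1 := by positivity
  have hfirst : a / (20 * ((t : ℝ) + 1) ^ (g₁ - 2 * g₃)) ≤ 1 / ((t : ℝ) + 1) ^ g₂ := by
    have hpow : ((t : ℝ) + 1) ^ g₂ ≤ ((t : ℝ) + 1) ^ (g₁ - 2 * g₃) :=
      rpow_le_rpow_of_exponent_le (by linarith) hg
    have hpos : 0 < ((t : ℝ) + 1) ^ g₂ := rpow_pos_of_pos hs0 _
    rw [div_le_div_iff₀ (by positivity) hpos]
    nlinarith [mul_le_mul ha hpow hpos.le (by norm_num)]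
  have hdiff : (t : ℝ) / ((t : ℝ) + 1) ^ g₂ ≤ (t : ℝ) / (t : ℝ) ^ g₂ := by
    have hpow : (t : ℝ) ^ g₂ ≤ ((t : ℝ) + 1) ^ g₂ :=
      rpow_le_rpow ht0.le (by linarith) hg₂
    gcongr
  rw [rpow_sub hs0 1 g₂, rpow_sub ht0 1 g₂, rpow_one, rpow_one, add_div]
  have htwo : 2 / ((t : ℝ) + 1) ^ g₂ = 1 / ((t : ℝ) + 1) ^ g₂ + 1 / ((t : ℝ) + 1) ^ g₂ := by
    ring
  linarith
end

section
/- Let p be a positive integer, δ > 0, and let l : ℝ^p → ℝ be Lipschitz. Define l̂(x) = E_{v∼Unif(𝔹^p)}[l(x + δ v)], where the expectation is with respect to the uniform probability distribution on the closed unit ball 𝔹^p ⊂ ℝ^p. Then l̂ is differentiable at every x ∈ ℝ^p and its gradient satisfies ∇l̂(x) = (p/δ) · E_{u∼Unif(𝕊^{p−1})}[ l(x + δ u) u ], where the expectation is the (vector-valued) integral with respect to the uniform probability distribution on the unit sphere 𝕊^{p−1} = { u ∈ ℝ^p : ‖u‖ = 1 }. -/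
open MeasureTheory

section Polar

variable {E F : Type*} [NormedAddCommGroup E] [NormedSpace ℝ E] [MeasurableSpace E] [BorelSpace E]
  [FiniteDimensional ℝ E] [Nontrivial E] [NormedAddCommGroup F] [NormedSpace ℝ F]

/-- Integration in polar coordinates. -/
theorem integral_eq_integral_Ioi_integral_toSphere (μ : Measure E) [μ.IsAddHaarMeasure]
    {g : E → F} (hg : Integrable g μ) :
    ∫ x, g x ∂μ = ∫ r in Set.Ioi (0 : ℝ), r ^ (Module.finrank ℝ E - 1) •
      ∫ u : Metric.sphere (0 : E) 1, g (r • (u : E)) ∂μ.toSphere := by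
  have hmp := μ.measurePreserving_homeomorphUnitSphereProd
  have hemb := (homeomorphUnitSphereProd E).measurableEmbedding
  have hpt : ∀ x : ({0}ᶜ : Set E), g ((homeomorphUnitSphereProd E x).2.1 •
      ((homeomorphUnitSphereProd E x).1 : E)) = g x := fun x ↦ by
    rw [← homeomorphUnitSphereProd_symm_apply_coe, Homeomorph.symm_apply_apply]
  have hint : Integrable
      (fun z : Metric.sphere (0 : E) 1 × Set.Ioi (0 : ℝ) ↦ g (z.2.1 • (z.1 : E)))
      (μ.toSphere.prod (.volumeIoiPow (Module.finrank ℝ E - 1))) := by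
    rw [← hmp.integrable_comp_emb hemb]
    simp only [Function.comp_def, hpt]
    exact (integrableOn_iff_comap_subtypeVal (measurableSet_singleton _).compl).1 hg.integrableOn
  calc
    ∫ x, g x ∂μ = ∫ x : ({0}ᶜ : Set E), g x ∂(μ.comap (↑)) := by
      rw [integral_subtype_comap (measurableSet_singleton _).compl g,
        restrict_compl_singleton]
    _ = ∫ z : Metric.sphere (0 : E) 1 × Set.Ioi (0 : ℝ), g (z.2.1 • (z.1 : E))
        ∂μ.toSphere.prod (.volumeIoiPow (Module.finrank ℝ E - 1)) := by
      rw [← hmp.integral_comp hemb]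
      simp only [hpt]
    _ = ∫ r : Set.Ioi (0 : ℝ), ∫ u : Metric.sphere (0 : E) 1, g (r.1 • (u : E)) ∂μ.toSphere
        ∂.volumeIoiPow (Module.finrank ℝ E - 1) := integral_prod_symm _ hint
    _ = _ := by
      rw [Measure.volumeIoiPow, integral_withDensity_eq_integral_toReal_smul (by fun_prop)
          (by simp),
        integral_subtype_comap measurableSet_Ioi fun r : ℝ ↦
          (ENNReal.ofReal (r ^ (Module.finrank ℝ E - 1))).toReal •
            ∫ u : Metric.sphere (0 : E) 1, g (r • (u : E)) ∂μ.toSphere]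
      refine setIntegral_congr_fun measurableSet_Ioi fun r hr ↦ ?_
      simp only [ENNReal.toReal_ofReal (pow_nonneg (le_of_lt hr) _)]

end Polar

section Divergence

theorem lipschitzWith_max_sub_norm {E : Type*} [SeminormedAddCommGroup E] (R : ℝ) :
    LipschitzWith 1 fun v : E ↦ max (R - ‖v‖) 0 := by
  refine LipschitzWith.max_const (.of_dist_le_mul fun v w ↦ ?_) 0
  simpa [Real.dist_eq, abs_sub_comm, dist_eq_norm] using abs_norm_sub_norm_le v w

theorem hasCompactSupport_max_sub_norm {E : Type*} [SeminormedAddCommGroup E] [ProperSpace E]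
    (R : ℝ) : HasCompactSupport fun v : E ↦ max (R - ‖v‖) 0 := by
  refine .intro (isCompact_closedBall 0 R) fun v hv ↦ ?_
  simp only [Metric.mem_closedBall, dist_zero_right, not_le] at hv
  exact max_eq_right (by linarith)

variable {E : Type*} [NormedAddCommGroup E] [InnerProductSpace ℝ E]

theorem lineDeriv_max_sub_norm {R : ℝ} {v : E} (hv : v ≠ 0) (hvR : ‖v‖ ≠ R) (e : E) :
    lineDeriv ℝ (fun v : E ↦ max (R - ‖v‖) 0) v e =
      (Metric.ball (0 : E) R).indicator (fun v ↦ -inner ℝ (‖v‖⁻¹ • v) e) v := by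
  have hc : ContinuousAt (fun t : ℝ ↦ ‖v + t • e‖) 0 := by fun_prop
  rcases hvR.lt_or_gt with h | h
  · rw [Set.indicator_of_mem (by simpa using h)]
    have hsq : HasDerivAt (fun t : ℝ ↦ ‖v + t • e‖ ^ 2) (2 * inner ℝ v e) 0 := by
      have := (((hasDerivAt_id (0 : ℝ)).smul_const e).const_add v).norm_sq
      simpa using this
    have hn := hsq.sqrt (by simpa using hv)
    simp only [Real.sqrt_sq (norm_nonneg _), zero_smul, add_zero] at hn
    have hd : HasDerivAt (fun t : ℝ ↦ max (R - ‖v + t • e‖) 0) (-inner ℝ (‖v‖⁻¹ • v) e) 0 := by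
      refine ((hn.const_sub R).congr_of_eventuallyEq ?_).congr_deriv ?_
      · filter_upwards [hc.eventually_lt_const (u := R) (by simpa using h)] with t ht
        exact max_eq_left (by linarith)
      · rw [real_inner_smul_left]
        have := norm_ne_zero_iff.2 hv
        field_simp
    exact hd.deriv
  · rw [Set.indicator_of_notMem (by simpa using h.le)]
    have hd : HasDerivAt (fun t : ℝ ↦ max (R - ‖v + t • e‖) 0) 0 0 := by
      refine (hasDerivAt_const (0 : ℝ) (0 : ℝ)).congr_of_eventuallyEq ?_
      filter_upwards [hc.eventually_const_lt (u := R) (by simpa using h)] with t ht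
      exact max_eq_right (by linarith)
    exact hd.deriv

variable [MeasurableSpace E] [BorelSpace E] [FiniteDimensional ℝ E]
  {f : E → ℝ} {K : NNReal}

theorem continuous_integral_toSphere_mul_inner (hf : Continuous f) (μ : Measure E)
    [μ.IsAddHaarMeasure] (e : E) : Continuous fun r : ℝ ↦
      ∫ u : Metric.sphere (0 : E) 1, f (r • (u : E)) * inner ℝ (u : E) e ∂μ.toSphere := by
  simpa using continuous_parametric_integral_of_continuous (μ := μ.toSphere)
    (f := fun (r : ℝ) (u : Metric.sphere (0 : E) 1) ↦ f (r • (u : E)) * inner ℝ (u : E) e)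
    (by unfold Function.uncurry; fun_prop) isCompact_univ

variable [Nontrivial E]

theorem LipschitzWith.hasDerivAt_integral_lineDeriv_mul_max_sub_norm (hf : LipschitzWith K f)
    (μ : Measure E) [μ.IsAddHaarMeasure] (e : E) :
    HasDerivAt (fun R : ℝ ↦ ∫ v, lineDeriv ℝ f v e * max (R - ‖v‖) 0 ∂μ)
      (∫ v in Metric.ball 0 1, lineDeriv ℝ f v e ∂μ) 1 := by
  have hmeas : AEStronglyMeasurable (fun v ↦ lineDeriv ℝ f v e) μ :=
    (hf.memLp_lineDeriv e).aestronglyMeasurable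
  have hsph : ∀ᵐ v ∂μ, v ∉ Metric.sphere (0 : E) 1 :=
    measure_eq_zero_iff_ae_notMem.1 (Measure.addHaar_sphere μ 0 1)
  rw [← integral_indicator measurableSet_ball]
  refine (hasDerivAt_integral_of_dominated_loc_of_lip
    (bound := (Metric.closedBall (0 : E) 2).indicator fun _ ↦ (K * ‖e‖ : ℝ))
    (Metric.ball_mem_nhds (1 : ℝ) one_pos) (.of_forall fun R ↦ ?_) ?_ ?_ (.of_forall fun v ↦ ?_)
    ?_ ?_).2
  · exact hmeas.mul (lipschitzWith_max_sub_norm R).continuous.aestronglyMeasurable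
  · exact ((lipschitzWith_max_sub_norm 1).continuous.integrable_of_hasCompactSupport
      (hasCompactSupport_max_sub_norm 1)).bdd_mul hmeas
      (.of_forall fun v ↦ norm_lineDeriv_le_of_lipschitz ℝ hf)
  · exact hmeas.indicator measurableSet_ball
  · refine .of_dist_le_mul fun R hR S hS ↦ ?_
    simp only [Metric.mem_ball, Real.dist_eq, abs_lt] at hR hS
    by_cases hv : v ∈ Metric.closedBall (0 : E) 2
    · rw [Set.indicator_of_mem hv, Real.dist_eq, ← mul_sub, abs_mul, Real.coe_nnabs,
        abs_of_nonneg (by positivity : (0 : ℝ) ≤ K * ‖e‖)]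
      gcongr
      · exact norm_lineDeriv_le_of_lipschitz ℝ hf
      · simpa [Real.dist_eq] using abs_max_sub_max_le_abs (R - ‖v‖) (S - ‖v‖) 0
    · simp only [Metric.mem_closedBall, dist_zero_right, not_le] at hv
      rw [max_eq_right (by linarith), max_eq_right (by linarith), dist_self]
      positivity
  · exact (integrable_indicator_iff measurableSet_closedBall).2
      (integrableOn_const measure_closedBall_lt_top.ne)
  · filter_upwards [hsph] with v hv
    rw [mem_sphere_zero_iff_norm] at hv
    have hd : HasDerivAt (fun R : ℝ ↦ max (R - ‖v‖) 0)
        ((Metric.ball (0 : E) 1).indicator (fun _ ↦ (1 : ℝ)) v) 1 := by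
      rcases Ne.lt_or_gt hv with h | h
      · rw [Set.indicator_of_mem (by simpa using h)]
        refine ((hasDerivAt_id (1 : ℝ)).sub_const ‖v‖).congr_of_eventuallyEq ?_
        filter_upwards [lt_mem_nhds h] with R hR
        exact max_eq_left (by simpa using hR.le)
      · rw [Set.indicator_of_notMem (by simpa using h.le)]
        refine (hasDerivAt_const (1 : ℝ) (0 : ℝ)).congr_of_eventuallyEq ?_
        filter_upwards [gt_mem_nhds h] with R hR
        exact max_eq_right (by linarith)
    refine (hd.const_mul (lineDeriv ℝ f v e)).congr_deriv ?_
    by_cases hb : v ∈ Metric.ball (0 : E) 1 <;> simp [hb]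

theorem LipschitzWith.integral_lineDeriv_mul_max_sub_norm (hf : LipschitzWith K f)
    (μ : Measure E) [μ.IsAddHaarMeasure] (e : E) {R : ℝ} (hR : 0 < R) :
    ∫ v, lineDeriv ℝ f v e * max (R - ‖v‖) 0 ∂μ =
      ∫ r in (0 : ℝ)..R, r ^ (Module.finrank ℝ E - 1) *
        ∫ u : Metric.sphere (0 : E) 1, f (r • (u : E)) * inner ℝ (u : E) e ∂μ.toSphere := by
  have hsph : ∀ᵐ v ∂μ, v ∉ Metric.sphere (0 : E) R :=
    measure_eq_zero_iff_ae_notMem.1 (Measure.addHaar_sphere μ 0 R)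
  have hzero : ∀ᵐ v ∂μ, v ≠ 0 := by simp [ae_iff]
  set g : E → ℝ := (Metric.ball (0 : E) R).indicator fun v ↦ f v * inner ℝ (‖v‖⁻¹ • v) e
  have hg : Integrable g μ := by
    refine (integrable_indicator_iff measurableSet_ball).2 ?_
    refine Integrable.mul_bdd (c := ‖e‖) ?_ ?_ (.of_forall fun v ↦ ?_)
    · exact (hf.continuous.continuousOn.integrableOn_compact
        (isCompact_closedBall (0 : E) R)).mono_set Metric.ball_subset_closedBall
    · exact Measurable.aestronglyMeasurable (by fun_prop)
    · refine (norm_inner_le_norm _ _).trans (mul_le_of_le_one_left (norm_nonneg _) ?_)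
      rw [norm_smul, norm_inv, norm_norm]
      exact inv_mul_le_one
  rw [hf.integral_lineDeriv_mul_eq (lipschitzWith_max_sub_norm R)
    (hasCompactSupport_max_sub_norm R)]
  calc
    _ = ∫ v, g v ∂μ := by
      refine integral_congr_ae ?_
      filter_upwards [hsph, hzero] with v hv hv0
      rw [lineDeriv_max_sub_norm hv0 (by simpa using hv)]
      by_cases hb : v ∈ Metric.ball (0 : E) R <;> simp [g, hb, -Metric.mem_ball, mul_comm]
    _ = _ := by
      rw [integral_eq_integral_Ioi_integral_toSphere μ hg, intervalIntegral.integral_of_le hR.le,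
        integral_Ioc_eq_integral_Ioo, ← Set.Ioi_inter_Iio,
        ← setIntegral_indicator measurableSet_Iio]
      refine setIntegral_congr_fun measurableSet_Ioi fun r hr ↦ ?_
      have hr : 0 < r := hr
      have hn (u : Metric.sphere (0 : E) 1) : ‖r • (u : E)‖ = r := by simp [norm_smul, hr.le]
      by_cases h : r < R
      · rw [Set.indicator_of_mem (by simpa using h)]
        simp only [smul_eq_mul]
        congr 2 with u
        simp only [g]
        rw [Set.indicator_of_mem (by simpa [hn] using h), hn, inv_smul_smul₀ hr.ne']
      · rw [Set.indicator_of_notMem (by simpa using h)]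
        have hg0 (u : Metric.sphere (0 : E) 1) : g (r • (u : E)) = 0 :=
          Set.indicator_of_notMem (by simpa [hn] using h) _
        simp [hg0]

/-- The divergence theorem on the unit ball for Lipschitz functions. -/
theorem LipschitzWith.integral_ball_lineDeriv (hf : LipschitzWith K f)
    (μ : Measure E) [μ.IsAddHaarMeasure] (e : E) :
    ∫ v in Metric.ball 0 1, lineDeriv ℝ f v e ∂μ =
      ∫ u : Metric.sphere (0 : E) 1, f u * inner ℝ (u : E) e ∂μ.toSphere := by
  have hc := (continuous_pow (M := ℝ) (Module.finrank ℝ E - 1)).mul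
    (continuous_integral_toSphere_mul_inner hf.continuous μ e)
  have h1 := intervalIntegral.integral_hasDerivAt_right (hc.intervalIntegrable 0 1)
    (hc.stronglyMeasurableAtFilter _ _) hc.continuousAt
  have h2 := (hf.hasDerivAt_integral_lineDeriv_mul_max_sub_norm μ e).congr_of_eventuallyEq
    (f₁ := fun R ↦ ∫ r in (0 : ℝ)..R, r ^ (Module.finrank ℝ E - 1) *
      ∫ u : Metric.sphere (0 : E) 1, f (r • (u : E)) * inner ℝ (u : E) e ∂μ.toSphere) (by
        filter_upwards [lt_mem_nhds one_pos] with R hR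
        exact (hf.integral_lineDeriv_mul_max_sub_norm μ e hR).symm)
  simpa using h2.unique h1

end Divergence

section Smoothing

theorem LipschitzWith.comp_add_smul {E : Type*} [SeminormedAddCommGroup E] [NormedSpace ℝ E]
    {l : E → ℝ} {K : NNReal} (hl : LipschitzWith K l) (x : E) (δ : ℝ) :
    LipschitzWith (K * ‖δ‖₊) fun v ↦ l (x + δ • v) := by
  have h := (LipschitzWith.const x).add (lipschitzWith_smul (β := E) δ)
  rw [zero_add] at h
  exact hl.comp h

variable {E : Type*} [NormedAddCommGroup E] [NormedSpace ℝ E] [MeasurableSpace E] [BorelSpace E]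
  [FiniteDimensional ℝ E] {l : E → ℝ} {K : NNReal}

theorem LipschitzWith.ae_hasFDerivAt_add_smul (hl : LipschitzWith K l) (μ : Measure E)
    [μ.IsAddHaarMeasure] (x : E) {δ : ℝ} (hδ : δ ≠ 0) :
    ∀ᵐ v ∂μ, HasFDerivAt l (fderiv ℝ l (x + δ • v)) (x + δ • v) := by
  filter_upwards [(hl.comp_add_smul x δ).ae_differentiableAt (μ := μ)] with v hv
  have hl_eq : l = (fun w ↦ l (x + δ • w)) ∘ fun y ↦ δ⁻¹ • (y - x) := by
    ext y
    simp [smul_inv_smul₀ hδ]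
  have hd : DifferentiableAt ℝ l (x + δ • v) := by
    rw [hl_eq]
    refine DifferentiableAt.comp _ ?_ (by fun_prop)
    simpa [inv_smul_smul₀ hδ] using hv
  exact hd.hasFDerivAt

/-- Averaging translates of a Lipschitz function against a finite absolutely continuous measure
gives a differentiable function. -/
theorem LipschitzWith.hasFDerivAt_integral_add_smul (hl : LipschitzWith K l) (μ : Measure E)
    [μ.IsAddHaarMeasure] {ν : Measure E} [IsFiniteMeasure ν] (hν : ν ≪ μ) (x : E) {δ : ℝ}
    (hδ : δ ≠ 0) (hint : Integrable (fun v ↦ l (x + δ • v)) ν) :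
    Integrable (fun v ↦ fderiv ℝ l (x + δ • v)) ν ∧
      HasFDerivAt (fun y ↦ ∫ v, l (y + δ • v) ∂ν) (∫ v, fderiv ℝ l (x + δ • v) ∂ν) x := by
  refine hasFDerivAt_integral_of_dominated_loc_of_lip (bound := fun _ ↦ (K : ℝ)) Filter.univ_mem
    (.of_forall fun y ↦ (hl.comp_add_smul y δ).continuous.aestronglyMeasurable) hint ?_
    (.of_forall fun v ↦ ?_) (integrable_const _) ?_
  · exact ((measurable_fderiv ℝ l).comp (g := fderiv ℝ l) (f := fun v ↦ x + δ • v)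
      (by fun_prop)).aestronglyMeasurable
  · refine LipschitzWith.lipschitzOnWith (.of_dist_le_mul fun y z ↦ ?_)
    simpa using hl.dist_le_mul (y + δ • v) (z + δ • v)
  · filter_upwards [hν.ae_le (hl.ae_hasFDerivAt_add_smul μ x hδ)] with v hv
    exact (hasFDerivAt_comp_add_right (δ • v)).2 hv

end Smoothing

/-- For Lipschitz `l : ℝ^p → ℝ` and `δ > 0`, the ball-smoothed function
`l̂(x) = E_{v ∼ Unif(𝔹^p)}[l(x + δ v)]` is differentiable everywhere with gradient
`∇l̂(x) = (p/δ) E_{u ∼ Unif(𝕊^{p−1})}[l(x + δ u) u]`, where the ball expectation is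
with respect to the normalized Lebesgue measure on the closed unit ball and the sphere
expectation is with respect to the normalized uniform (surface) measure on the unit
sphere. -/
theorem stmt_18 (p : ℕ) (hp : 0 < p) (δ : ℝ) (hδ : 0 < δ)
    (l : EuclideanSpace ℝ (Fin p) → ℝ)
    (hlip : ∃ K : NNReal, LipschitzWith K l)
    (μ : Measure (EuclideanSpace ℝ (Fin p)))
    (hμ : μ = (volume (Metric.closedBall (0 : EuclideanSpace ℝ (Fin p)) 1))⁻¹ •
      volume.restrict (Metric.closedBall (0 : EuclideanSpace ℝ (Fin p)) 1))
    (lhat : EuclideanSpace ℝ (Fin p) → ℝ)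
    (hlhat : ∀ x, lhat x = ∫ v, l (x + δ • v) ∂μ)
    (σ : Measure (Metric.sphere (0 : EuclideanSpace ℝ (Fin p)) 1))
    (hσ : σ = ((volume : Measure (EuclideanSpace ℝ (Fin p))).toSphere Set.univ)⁻¹ •
      (volume : Measure (EuclideanSpace ℝ (Fin p))).toSphere) :
    ∀ x : EuclideanSpace ℝ (Fin p),
      HasGradientAt lhat
        (((p : ℝ) / δ) •
          ∫ u : Metric.sphere (0 : EuclideanSpace ℝ (Fin p)) 1,
            l (x + δ • (u : EuclideanSpace ℝ (Fin p))) •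
              (u : EuclideanSpace ℝ (Fin p)) ∂σ) x := by
  obtain ⟨K, hl⟩ := hlip
  have : Nonempty (Fin p) := ⟨⟨0, hp⟩⟩
  intro x
  set B := volume (Metric.ball (0 : EuclideanSpace ℝ (Fin p)) 1)
  have hB0 : B ≠ 0 := (Metric.measure_ball_pos volume 0 one_pos).ne'
  have hBtop : B ≠ ⊤ := measure_ball_lt_top.ne
  have hsphere : (volume : Measure (EuclideanSpace ℝ (Fin p))).toSphere Set.univ = p * B := by
    rw [Measure.toSphere_apply_univ, finrank_euclideanSpace_fin]
  have hball : Metric.closedBall (0 : EuclideanSpace ℝ (Fin p)) 1 =ᵐ[volume] Metric.ball 0 1 :=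
    (ae_eq_of_subset_of_measure_ge Metric.ball_subset_closedBall
      (Measure.addHaar_closedBall_eq_addHaar_ball volume (0 : EuclideanSpace ℝ (Fin p)) 1).le
      measurableSet_ball.nullMeasurableSet measure_closedBall_lt_top.ne).symm
  rw [measure_congr hball, Measure.restrict_congr_set hball] at hμ
  change μ = B⁻¹ • _ at hμ
  have hfin : IsFiniteMeasure μ := by
    have : IsFiniteMeasure (volume.restrict (Metric.ball (0 : EuclideanSpace ℝ (Fin p)) 1)) :=
      isFiniteMeasure_restrict.2 hBtop
    rw [hμ]
    exact Measure.smul_finite _ (ENNReal.inv_ne_top.2 hB0)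
  have hac : μ ≪ volume := by
    rw [hμ]
    exact Measure.restrict_le_self.absolutelyContinuous.smul_left _
  set f : EuclideanSpace ℝ (Fin p) → ℝ := fun v ↦ l (x + δ • v)
  have hf := hl.comp_add_smul x δ
  have hint : Integrable f μ := by
    rw [hμ]
    exact ((hf.continuous.continuousOn.integrableOn_compact
      (isCompact_closedBall 0 1)).mono_set Metric.ball_subset_closedBall).smul_measure
      (ENNReal.inv_ne_top.2 hB0)
  obtain ⟨hint', hderiv⟩ := hl.hasFDerivAt_integral_add_smul volume hac x hδ.ne' hint
  rw [hasGradientAt_iff_hasFDerivAt, funext hlhat]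
  refine hderiv.congr_fderiv (ContinuousLinearMap.ext fun e ↦ ?_)
  have hline : ∀ᵐ v ∂μ, fderiv ℝ l (x + δ • v) e = δ⁻¹ * lineDeriv ℝ f v e := by
    filter_upwards [hac.ae_le (hl.ae_hasFDerivAt_add_smul volume x hδ.ne')] with v hv
    have hfv : HasFDerivAt f ((fderiv ℝ l (x + δ • v)).comp (δ • .id ℝ _)) v :=
      hv.comp v (((hasFDerivAt_id v).const_smul δ).const_add x)
    rw [(hfv.hasLineDerivAt e).lineDeriv]
    simp [hδ.ne']
  have hsint : Integrable
      (fun u : Metric.sphere (0 : EuclideanSpace ℝ (Fin p)) 1 ↦ f u • u.1) σ := by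
    have hσfin : IsFiniteMeasure σ := by
      rw [hσ, hsphere]
      exact Measure.smul_finite _ (ENNReal.inv_ne_top.2 (by simp [hB0, hp.ne']))
    have hcont : Continuous fun u : Metric.sphere (0 : EuclideanSpace ℝ (Fin p)) 1 ↦ f u • u.1 :=
      (hf.continuous.comp continuous_subtype_val).smul continuous_subtype_val
    exact hcont.integrable_of_hasCompactSupport (.of_compactSpace _)
  rw [ContinuousLinearMap.integral_apply hint', integral_congr_ae hline, integral_const_mul,
    InnerProductSpace.toDual_apply_apply, real_inner_smul_left, real_inner_comm,
    ← integral_inner hsint, hμ, hσ, integral_smul_measure, integral_smul_measure,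
    hf.integral_ball_lineDeriv, hsphere]
  simp only [real_inner_smul_right, real_inner_comm e, ENNReal.toReal_inv, ENNReal.toReal_mul,
    ENNReal.toReal_natCast, smul_eq_mul]
  have hp' : (p : ℝ) ≠ 0 := by exact_mod_cast hp.ne'
  have hB' : B.toReal ≠ 0 := ENNReal.toReal_ne_zero.2 ⟨hB0, hBtop⟩
  field_simp
  rfl
end
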